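/- arXiv:2504.03074 — 5 statements merged into one kernel-verified Lean document; each statement's English description precedes it below -/
import Mathlib

section
/- For every real x with |x| ≤ 2, the series Σ_{μ=0}^∞ b_μ x^{2μ+2} with b_μ = 2 (μ!)^2 / (2μ+2)! converges and its sum equals (2 arcsin(x/2))^2. -/
open Real

/-- The partial sums of `∑ 2 (n!)² / (2n+2)! x^(2n+2)` at `x = 2 sin t`. -/
noncomputable def arcsinSqPartialSum (N : ℕ) (t : ℝ) : ℝ :=
  ∑ n ∈ Finset.range N,
    (2 * (Nat.factorial n : ℝ) ^ 2 / (Nat.factorial (2 * n + 2))) * (2 * sin t) ^ (2 * n + 2)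

/-- The first derivative of `arcsinSqPartialSum N`. -/
noncomputable def arcsinSqPartialSumDeriv (N : ℕ) (t : ℝ) : ℝ :=
  ∑ n ∈ Finset.range N,
    (2 * (Nat.factorial n : ℝ) ^ 2 / (Nat.factorial (2 * n + 2))) *
      ((2 * n + 2) * (2 * sin t) ^ (2 * n + 1) * (2 * cos t))

/-- The reciprocal `4^n / (2n choose n)` of the normalized central binomial coefficient. -/
noncomputable def invCentralBinomRatio (n : ℕ) : ℝ :=
  4 ^ n * (Nat.factorial n : ℝ) ^ 2 / (Nat.factorial (2 * n))

lemma invCentralBinomRatio_nonneg (n : ℕ) : 0 ≤ invCentralBinomRatio n := by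
  unfold invCentralBinomRatio
  positivity

lemma invCentralBinomRatio_succ (n : ℕ) :
    invCentralBinomRatio (n + 1) = invCentralBinomRatio n * ((2 * n + 2) / (2 * n + 1)) := by
  unfold invCentralBinomRatio
  have h : (2 * (n + 1)) = 2 * n + 1 + 1 := by ring
  have h0 : ((Nat.factorial (2 * n) : ℕ) : ℝ) ≠ 0 := by positivity
  have h1 : (2 * n + 1 : ℝ) ≠ 0 := by positivity
  have h2 : (2 * n + 1 + 1 : ℝ) ≠ 0 := by positivity
  rw [h, Nat.factorial_succ, Nat.factorial_succ, Nat.factorial_succ]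
  push_cast
  field_simp
  ring

lemma invCentralBinomRatio_sq_le (n : ℕ) : invCentralBinomRatio n ^ 2 ≤ 4 * n + 1 := by
  induction n with
  | zero => simp [invCentralBinomRatio]
  | succ n ih =>
    rw [invCentralBinomRatio_succ, mul_pow, div_pow]
    refine (mul_le_mul_of_nonneg_right ih (by positivity)).trans ?_
    rw [← mul_div_assoc, div_le_iff₀ (by positivity)]
    push_cast
    nlinarith

lemma tendsto_invCentralBinomRatio_div :
    Filter.Tendsto (fun n : ℕ => invCentralBinomRatio n / (2 * n + 1)) Filter.atTop (nhds 0) := by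
  have h : Filter.Tendsto (fun n : ℕ => √(4 * (1 / ((n : ℝ) + 1)))) Filter.atTop (nhds 0) := by
    simpa using ((tendsto_one_div_add_atTop_nhds_zero_nat (𝕜 := ℝ)).const_mul 4).sqrt
  refine squeeze_zero (fun n => div_nonneg (invCentralBinomRatio_nonneg n) (by positivity))
    (fun n => le_sqrt_of_sq_le ?_) h
  rw [div_pow, mul_one_div, div_le_div_iff₀ (by positivity) (by positivity)]
  have hn : (0 : ℝ) ≤ n := n.cast_nonneg
  nlinarith [invCentralBinomRatio_sq_le n]

lemma hasDerivAt_arcsinSqPartialSum (N : ℕ) (t : ℝ) :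
    HasDerivAt (arcsinSqPartialSum N) (arcsinSqPartialSumDeriv N t) t := by
  unfold arcsinSqPartialSum arcsinSqPartialSumDeriv
  refine HasDerivAt.fun_sum fun n _ => HasDerivAt.const_mul _ ?_
  convert ((hasDerivAt_sin t).const_mul 2).fun_pow (2 * n + 2) using 1
  push_cast
  rfl

lemma hasDerivAt_arcsinSqPartialSumDeriv (N : ℕ) (t : ℝ) :
    HasDerivAt (arcsinSqPartialSumDeriv N)
      (8 - 8 * invCentralBinomRatio N * sin t ^ (2 * N)) t := by
  have htel := Finset.sum_range_sub' (fun n => 8 * invCentralBinomRatio n * sin t ^ (2 * n)) N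
  have h0 : invCentralBinomRatio 0 = 1 := by simp [invCentralBinomRatio]
  simp only [h0, mul_zero, pow_zero, mul_one] at htel
  rw [← htel]
  unfold arcsinSqPartialSumDeriv
  refine HasDerivAt.fun_sum fun n _ => ?_
  have h := (((((hasDerivAt_sin t).const_mul 2).fun_pow (2 * n + 1)).const_mul
    (2 * n + 2 : ℝ)).mul ((hasDerivAt_cos t).const_mul 2)).const_mul
    (2 * (Nat.factorial n : ℝ) ^ 2 / (Nat.factorial (2 * n + 2)))
  refine h.congr_deriv ?_
  have hc : cos t * cos t = 1 - sin t ^ 2 := by rw [← cos_sq', sq]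
  have hF : ((Nat.factorial (2 * n) : ℕ) : ℝ) ≠ 0 := by positivity
  have h1 : (2 * n + 1 : ℝ) ≠ 0 := by positivity
  have h2 : (2 * n + 1 + 1 : ℝ) ≠ 0 := by positivity
  have hb : (2 * (Nat.factorial n : ℝ) ^ 2 / (Nat.factorial (2 * n + 2))) =
      2 * invCentralBinomRatio n / (4 ^ n * ((2 * n + 1) * (2 * n + 1 + 1))) := by
    rw [invCentralBinomRatio, Nat.factorial_succ, Nat.factorial_succ]
    push_cast
    field_simp
  have hs : (2 * sin t) ^ (2 * n) = 4 ^ n * sin t ^ (2 * n) := by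
    rw [mul_pow, pow_mul]; norm_num
  have hrhs : ((2 * n + 2 : ℝ) * (((2 * n + 1 : ℕ) : ℝ) * (2 * sin t) ^ (2 * n + 1 - 1) *
        (2 * cos t)) * (2 * cos t) +
      (2 * n + 2) * (2 * sin t) ^ (2 * n + 1) * (2 * -sin t)) =
      (2 * n + 2) * 4 * (4 ^ n * sin t ^ (2 * n)) *
        ((2 * n + 1) * (1 - sin t ^ 2) - sin t ^ 2) := by
    rw [Nat.add_sub_cancel, pow_succ, hs, ← hc]
    push_cast
    ring
  rw [hrhs, hb, invCentralBinomRatio_succ]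
  field_simp
  ring

lemma arcsinSqPartialSum_bounds (N : ℕ) {t : ℝ} (ht0 : 0 ≤ t) (ht : t ≤ π / 2) :
    arcsinSqPartialSum N t ≤ 4 * t ^ 2 ∧
      4 * t ^ 2 - arcsinSqPartialSum N t ≤
        4 * π * (invCentralBinomRatio N / (2 * N + 1)) := by
  set c := invCentralBinomRatio N
  have hc0 : 0 ≤ c := invCentralBinomRatio_nonneg N
  set f : ℝ → ℝ := fun t => 4 * t ^ 2 - arcsinSqPartialSum N t with hf
  set g : ℝ → ℝ := fun t => 8 * t - arcsinSqPartialSumDeriv N t with hg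
  have hf' (t : ℝ) : HasDerivAt f (g t) t := by
    refine (((hasDerivAt_pow 2 t).const_mul 4).sub
      (hasDerivAt_arcsinSqPartialSum N t)).congr_deriv ?_
    simp only [hg]
    norm_num
    ring
  have hg' (t : ℝ) : HasDerivAt g (8 * c * sin t ^ (2 * N)) t := by
    refine (((hasDerivAt_id t).const_mul 8).sub
      (hasDerivAt_arcsinSqPartialSumDeriv N t)).congr_deriv ?_
    ring
  have hf0 : f 0 = 0 := by simp [hf, arcsinSqPartialSum]
  have hg0 : g 0 = 0 := by simp [hg, arcsinSqPartialSumDeriv]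
  have hg_nonneg {t : ℝ} (ht : 0 ≤ t) : 0 ≤ g t := by
    have := monotone_of_hasDerivAt_nonneg hg' fun t => by
      have : 0 ≤ sin t ^ (2 * N) := (even_two_mul N).pow_nonneg _
      positivity
    simpa [hg0] using this ht
  have hf_mono : MonotoneOn f (Set.Ici 0) := by
    refine monotoneOn_of_hasDerivWithinAt_nonneg (convex_Ici 0)
      (fun t _ => (hf' t).continuousAt.continuousWithinAt)
      (fun t _ => (hf' t).hasDerivWithinAt) fun t h => ?_
    rw [interior_Ici] at h
    exact hg_nonneg (le_of_lt h)
  have hf_nonneg : 0 ≤ f t := hf0 ▸ hf_mono Set.self_mem_Ici ht0 ht0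
  -- The correction `(π / 2 - t) g t` turns the bound into Jordan's inequality for `cos`.
  set F : ℝ → ℝ := fun t =>
    f t + (π / 2 - t) * g t - 4 * π * (c / (2 * N + 1)) * sin t ^ (2 * N + 1) with hF
  have hN : (2 * N + 1 : ℝ) ≠ 0 := by positivity
  have hF' (t : ℝ) : HasDerivAt F
      (8 * c * sin t ^ (2 * N) * ((π / 2 - t) - π / 2 * cos t)) t := by
    refine (((hf' t).add (((hasDerivAt_id t).const_sub (π / 2)).mul (hg' t))).sub
      (((hasDerivAt_sin t).fun_pow (2 * N + 1)).const_mul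
        (4 * π * (c / (2 * N + 1))))).congr_deriv ?_
    simp only [id, Nat.add_sub_cancel]
    push_cast
    field_simp
    ring
  have hF_anti : AntitoneOn F (Set.Icc 0 (π / 2)) := by
    refine antitoneOn_of_hasDerivWithinAt_nonpos (convex_Icc 0 (π / 2))
      (fun t _ => (hF' t).continuousAt.continuousWithinAt)
      (fun t _ => (hF' t).hasDerivWithinAt) fun t h => ?_
    rw [interior_Icc] at h
    have hs : 0 ≤ sin t ^ (2 * N) := (even_two_mul N).pow_nonneg _
    have hj := mul_le_sin (x := π / 2 - t) (by linarith [h.2]) (by linarith [h.1])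
    rw [sin_pi_div_two_sub, div_mul_eq_mul_div, div_le_iff₀ pi_pos] at hj
    exact mul_nonpos_of_nonneg_of_nonpos (by positivity) (by linarith)
  have hFt := hF_anti ⟨le_rfl, by positivity⟩ ⟨ht0, ht⟩ ht0
  have hF0 : F 0 = 0 := by simp [hF, hf0, hg0]
  rw [hF0] at hFt
  have hcor : 0 ≤ (π / 2 - t) * g t := mul_nonneg (by linarith) (hg_nonneg ht0)
  have hsin : sin t ^ (2 * N + 1) ≤ 1 :=
    pow_le_one₀ (sin_nonneg_of_nonneg_of_le_pi ht0 (by linarith [pi_pos])) (sin_le_one t)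
  have hK : 0 ≤ 4 * π * (c / (2 * N + 1)) := by positivity
  have hle := mul_le_of_le_one_right hK hsin
  simp only [hF] at hFt
  exact ⟨sub_nonneg.mp hf_nonneg, by change f t ≤ _; linarith⟩

lemma tendsto_arcsinSqPartialSum {t : ℝ} (ht0 : 0 ≤ t) (ht : t ≤ π / 2) :
    Filter.Tendsto (fun N => arcsinSqPartialSum N t) Filter.atTop (nhds (4 * t ^ 2)) := by
  have h := (tendsto_invCentralBinomRatio_div.const_mul (4 * π)).const_sub (4 * t ^ 2)
  rw [mul_zero, sub_zero] at h
  refine tendsto_of_tendsto_of_tendsto_of_le_of_le h tendsto_const_nhds (fun N => ?_) fun N => ?_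
  · linarith [(arcsinSqPartialSum_bounds N ht0 ht).2]
  · exact (arcsinSqPartialSum_bounds N ht0 ht).1

theorem b_mu_series_arcsin (x : ℝ) (hx : |x| ≤ 2) :
    HasSum
      (fun μ : ℕ =>
        (2 * (Nat.factorial μ : ℝ) ^ 2 / (Nat.factorial (2 * μ + 2))) * x ^ (2 * μ + 2))
      ((2 * Real.arcsin (x / 2)) ^ 2) := by
  wlog h0 : 0 ≤ x generalizing x
  · have h := this (-x) (by rwa [abs_neg]) (by linarith)
    have he (μ : ℕ) : (-x) ^ (2 * μ + 2) = x ^ (2 * μ + 2) := Even.neg_pow ⟨μ + 1, by ring⟩ x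
    simpa only [he, neg_div, arcsin_neg, mul_neg, neg_sq] using h
  rw [hasSum_iff_tendsto_nat_of_nonneg fun μ => by positivity]
  have h2 := (abs_le.mp hx).2
  have h := tendsto_arcsinSqPartialSum (arcsin_nonneg.mpr (by positivity : 0 ≤ x / 2))
    (arcsin_le_pi_div_two _)
  unfold arcsinSqPartialSum at h
  rw [sin_arcsin (by linarith) (by linarith), mul_div_cancel₀ x two_ne_zero] at h
  convert h using 2
  ring
end

section
/- For every natural number M ≥ 1, as θ → 0 one has Σ_{μ=0}^{M−1} b_μ (2 sin(θ/2))^{2μ+2} = θ^2 − b_M θ^{2M+2} + O(θ^{2M+4}), where b_μ = 2 (μ!)^2 / (2μ+2)!. In particular, with M = p/2, the symbol of the order-p central difference approximation of −∂_x^2 reproduces θ^2 with leading truncation error −b_{p/2} θ^{p+2}. -/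
open Real Filter Asymptotics Topology

theorem isBigO_pow_succ_of_hasDerivAt {f f' : ℝ → ℝ} {n : ℕ}
    (hf : ∀ x, HasDerivAt f (f' x) x) (h0 : f 0 = 0)
    (h : f' =O[𝓝 0] fun x => x ^ n) : f =O[𝓝 0] fun x => x ^ (n + 1) := by
  obtain ⟨C, hC, h⟩ := h.exists_nonneg
  obtain ⟨ε, hε, hb⟩ := Metric.eventually_nhds_iff.1 h.bound
  refine IsBigO.of_bound C (Metric.eventually_nhds_iff.2 ⟨ε, hε, fun x hx => ?_⟩)
  rw [dist_zero_right] at hx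
  have key := (convex_closedBall (0 : ℝ) ‖x‖).norm_image_sub_le_of_norm_hasDerivWithin_le
    (f := f) (f' := f') (C := C * ‖x‖ ^ n) (x := 0) (y := x)
    (fun y _ => (hf y).hasDerivWithinAt) (fun y hy => ?_) (by simp) (by simp)
  · simpa [h0, pow_succ, mul_assoc] using key
  · rw [mem_closedBall_zero_iff] at hy
    refine (hb (by rw [dist_zero_right]; exact hy.trans_lt hx)).trans ?_
    rw [norm_pow]
    gcongr

theorem isBigO_pow_add_two_of_hasDerivAt {f f' f'' : ℝ → ℝ} {n : ℕ}
    (hf : ∀ x, HasDerivAt f (f' x) x) (hf' : ∀ x, HasDerivAt f' (f'' x) x)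
    (h0 : f 0 = 0) (h0' : f' 0 = 0)
    (h : f'' =O[𝓝 0] fun x => x ^ n) : f =O[𝓝 0] fun x => x ^ (n + 2) :=
  isBigO_pow_succ_of_hasDerivAt hf h0 (isBigO_pow_succ_of_hasDerivAt hf' h0' h)

theorem hasDerivAt_two_mul_sin_half (θ : ℝ) :
    HasDerivAt (fun θ : ℝ => 2 * sin (θ / 2)) (cos (θ / 2)) θ := by
  refine (((hasDerivAt_id θ).div_const 2).sin.const_mul 2).congr_deriv ?_
  simp only [id]
  ring

theorem hasDerivAt_two_mul_sin_half_pow (k : ℕ) (θ : ℝ) :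
    HasDerivAt (fun θ : ℝ => (2 * sin (θ / 2)) ^ (k + 2))
      ((k + 2) * ((2 * sin (θ / 2)) ^ (k + 1) * cos (θ / 2))) θ := by
  refine ((hasDerivAt_two_mul_sin_half θ).pow (k + 2)).congr_deriv ?_
  push_cast
  ring

theorem hasDerivAt_two_mul_sin_half_pow_mul_cos_half (k : ℕ) (θ : ℝ) :
    HasDerivAt (fun θ : ℝ => (2 * sin (θ / 2)) ^ (k + 1) * cos (θ / 2))
      ((k + 1) * (2 * sin (θ / 2)) ^ k - (k + 2) / 4 * (2 * sin (θ / 2)) ^ (k + 2)) θ := by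
  refine (((hasDerivAt_two_mul_sin_half θ).pow (k + 1)).mul
    ((hasDerivAt_id θ).div_const 2).cos).congr_deriv ?_
  simp only [id, Pi.pow_apply]
  push_cast
  linear_combination (k + 1) * (2 * sin (θ / 2)) ^ k * sin_sq_add_cos_sq (θ / 2)

theorem isBigO_two_mul_sin_half : (fun θ : ℝ => 2 * sin (θ / 2)) =O[𝓝 0] fun θ => θ := by
  refine IsBigO.of_bound 1 (Eventually.of_forall fun θ => ?_)
  have h := abs_sin_le_abs (x := θ / 2)
  simp only [norm_eq_abs, abs_mul, abs_div, abs_two] at h ⊢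
  linarith

theorem isBigO_two_mul_sin_half_sq_sub :
    (fun θ : ℝ => (2 * sin (θ / 2)) ^ 2 - θ ^ 2) =O[𝓝 0] fun θ => θ ^ 4 := by
  refine isBigO_pow_add_two_of_hasDerivAt (n := 2)
    (fun θ => (hasDerivAt_two_mul_sin_half_pow 0 θ).sub (hasDerivAt_pow 2 θ))
    (fun θ => ((hasDerivAt_two_mul_sin_half_pow_mul_cos_half 0 θ).const_mul _).sub
      ((hasDerivAt_pow 1 θ).const_mul _)) (by simp) (by simp) ?_
  refine (isBigO_two_mul_sin_half.pow 2).neg_left.congr_left fun θ => ?_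
  push_cast
  ring

theorem isBigO_two_mul_sin_half_pow_sub (m : ℕ) :
    (fun θ : ℝ => (2 * sin (θ / 2)) ^ (2 * m) - θ ^ (2 * m)) =O[𝓝 0]
      fun θ => θ ^ (2 * m + 2) := by
  induction m with
  | zero => simpa using isBigO_zero _ _
  | succ m ih =>
    have h₁ := (isBigO_two_mul_sin_half.pow 2).mul ih
    have h₂ := isBigO_two_mul_sin_half_sq_sub.mul (isBigO_refl (fun θ : ℝ => θ ^ (2 * m)) (𝓝 0))
    refine ((h₁.congr_right fun θ => ?_).add (h₂.congr_right fun θ => ?_)).congr_left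
      fun θ => ?_ <;> ring

theorem sum_second_deriv_two_mul_sin_half_pow (M : ℕ) (s : ℝ) :
    ∑ μ ∈ Finset.range M, (2 * (Nat.factorial μ : ℝ) ^ 2 / (Nat.factorial (2 * μ + 2))) *
      (((2 * μ : ℕ) + 2) * (((2 * μ : ℕ) + 1) * s ^ (2 * μ) -
        ((2 * μ : ℕ) + 2) / 4 * s ^ (2 * μ + 2))) =
      2 - 2 * (Nat.factorial M : ℝ) ^ 2 / (Nat.factorial (2 * M)) * s ^ (2 * M) := by
  induction M with
  | zero => simp
  | succ M ih =>
    have h : (Nat.factorial (2 * M) : ℝ) ≠ 0 := by positivity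
    rw [Finset.sum_range_succ, ih, show 2 * (M + 1) = 2 * M + 2 by ring]
    simp only [Nat.factorial_succ]
    push_cast
    have h₁ : (2 * (M : ℝ) + 1) ≠ 0 := by positivity
    have h₂ : (2 * (M : ℝ) + 1 + 1) ≠ 0 := by positivity
    field_simp
    ring

theorem symbol_truncation_error (M : ℕ) (hM : 1 ≤ M) :
    (fun θ : ℝ =>
        (∑ μ ∈ Finset.range M,
          (2 * (Nat.factorial μ : ℝ) ^ 2 / (Nat.factorial (2 * μ + 2))) *
            (2 * Real.sin (θ / 2)) ^ (2 * μ + 2)) -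
        (θ ^ 2 -
          (2 * (Nat.factorial M : ℝ) ^ 2 / (Nat.factorial (2 * M + 2))) * θ ^ (2 * M + 2)))
      =O[𝓝 (0 : ℝ)] fun θ : ℝ => θ ^ (2 * M + 4) := by
  refine isBigO_pow_add_two_of_hasDerivAt (n := 2 * M + 2)
    (fun θ => (HasDerivAt.fun_sum fun μ _ =>
        (hasDerivAt_two_mul_sin_half_pow (2 * μ) θ).const_mul _).sub
      ((hasDerivAt_pow 2 θ).sub ((hasDerivAt_pow (2 * M + 2) θ).const_mul _)))
    (fun θ => (HasDerivAt.fun_sum fun μ _ =>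
        ((hasDerivAt_two_mul_sin_half_pow_mul_cos_half (2 * μ) θ).const_mul _).const_mul _).sub
      (((hasDerivAt_pow 1 θ).const_mul _).sub
        (((hasDerivAt_pow (2 * M + 1) θ).const_mul _).const_mul _)))
    (by simp) (by simp) ?_
  refine ((isBigO_two_mul_sin_half_pow_sub M).const_mul_left
    (-(2 * (Nat.factorial M : ℝ) ^ 2 / (Nat.factorial (2 * M))))).congr_left fun θ => ?_
  rw [sum_second_deriv_two_mul_sin_half_pow]
  have h : (Nat.factorial (2 * M) : ℝ) ≠ 0 := by positivity
  have h₁ : (2 * (M : ℝ) + 1) ≠ 0 := by positivity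
  have h₂ : (2 * (M : ℝ) + 1 + 1) ≠ 0 := by positivity
  simp only [Nat.factorial_succ, Nat.add_sub_cancel]
  push_cast
  field_simp
  ring
end

section
/- Let a < b, L = b − a, N a positive integer, Δx = L/N, x_j = a + jΔx, and let k > 0, κ > 0 be real with kΔx/2 ≤ 1. Define κ̃ = sin(κΔx/2)/(Δx/2) and k̃ = (2/Δx) arcsin(kΔx/2), and assume k^2 ≠ κ̃^2 and sin(k̃L) ≠ 0. Define U^f_j = cos(κ x_j)/(k^2 − κ̃^2) and U_j = U^f_j − U^f_N sin(k̃(x_j − a))/sin(k̃L) − U^f_0 sin(k̃(b − x_j))/sin(k̃L). Then (U_{j+1} − 2U_j + U_{j−1})/Δx^2 + k^2 U_j = cos(κ x_j) for j = 1, ..., N−1, and U_0 = 0 and U_N = 0. -/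
open Real

lemma sin_add_two_mul_add_sin_sub_two_mul (y θ : ℝ) :
    Real.sin (y + 2 * θ) + Real.sin (y - 2 * θ) = (2 - 4 * Real.sin θ ^ 2) * Real.sin y := by
  rw [Real.sin_add, Real.sin_sub, Real.cos_two_mul, Real.cos_sq']
  ring

lemma cos_add_two_mul_add_cos_sub_two_mul (y θ : ℝ) :
    Real.cos (y + 2 * θ) + Real.cos (y - 2 * θ) = (2 - 4 * Real.sin θ ^ 2) * Real.cos y := by
  rw [Real.cos_add, Real.cos_sub, Real.cos_two_mul, Real.cos_sq']
  ring

theorem discrete_helmholtz_bvp_solution (a b L Δx k κ kt κt : ℝ) (N : ℕ)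
    (hab : a < b) (hL : L = b - a) (hN : 0 < N) (hΔx : Δx = L / N)
    (hk : 0 < k) (hκ : 0 < κ) (hsmall : k * Δx / 2 ≤ 1)
    (hκt : κt = Real.sin (κ * Δx / 2) / (Δx / 2))
    (hkt : kt = (2 / Δx) * Real.arcsin (k * Δx / 2))
    (hnres : k ^ 2 ≠ κt ^ 2) (hsin : Real.sin (kt * L) ≠ 0)
    (x : ℤ → ℝ) (hx : ∀ j : ℤ, x j = a + j * Δx)
    (Uf : ℤ → ℝ) (hUf : ∀ j : ℤ, Uf j = Real.cos (κ * x j) / (k ^ 2 - κt ^ 2))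
    (U : ℤ → ℝ)
    (hU : ∀ j : ℤ, U j = Uf j
        - Uf N * Real.sin (kt * (x j - a)) / Real.sin (kt * L)
        - Uf 0 * Real.sin (kt * (b - x j)) / Real.sin (kt * L)) :
    (∀ j : ℤ, 1 ≤ j → j ≤ (N : ℤ) - 1 →
        (U (j + 1) - 2 * U j + U (j - 1)) / Δx ^ 2 + k ^ 2 * U j = Real.cos (κ * x j)) ∧
      U 0 = 0 ∧ U N = 0 := by
  have hN' : (0 : ℝ) < N := by exact_mod_cast hN
  have hd : 0 < Δx := by
    rw [hΔx, hL]
    exact div_pos (sub_pos.mpr hab) hN'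
  have hx0 : x 0 = a := by simp [hx]
  have hxN : x N = b := by
    rw [hx, hΔx, hL]
    push_cast
    field_simp
    ring
  have hsin_kt : Real.sin (kt * Δx / 2) = k * Δx / 2 := by
    have h : kt * Δx / 2 = Real.arcsin (k * Δx / 2) := by
      rw [hkt]
      field_simp
    rw [h, Real.sin_arcsin (by linarith [mul_pos hk hd]) hsmall]
  have hsin_κ : Real.sin (κ * Δx / 2) = κt * Δx / 2 := by
    rw [hκt]
    field_simp
  refine ⟨fun j _ _ => ?_, ?_, ?_⟩
  · have hsucc : x (j + 1) = x j + Δx := by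
      rw [hx, hx]
      push_cast
      ring
    have hpred : x (j - 1) = x j - Δx := by
      rw [hx, hx]
      push_cast
      ring
    have hleft : Real.sin (kt * (x (j + 1) - a)) + Real.sin (kt * (x (j - 1) - a))
        = (2 - (k * Δx) ^ 2) * Real.sin (kt * (x j - a)) := by
      have h := sin_add_two_mul_add_sin_sub_two_mul (kt * (x j - a)) (kt * Δx / 2)
      rw [hsin_kt] at h
      rw [hsucc, hpred]
      convert h using 2 <;> ring_nf
    have hright : Real.sin (kt * (b - x (j + 1))) + Real.sin (kt * (b - x (j - 1)))
        = (2 - (k * Δx) ^ 2) * Real.sin (kt * (b - x j)) := by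
      have h := sin_add_two_mul_add_sin_sub_two_mul (kt * (b - x j)) (kt * Δx / 2)
      rw [hsin_kt, add_comm (Real.sin _)] at h
      rw [hsucc, hpred]
      convert h using 2 <;> ring_nf
    have hforced : Uf (j + 1) + Uf (j - 1) = (2 - (κt * Δx) ^ 2) * Uf j := by
      have h := cos_add_two_mul_add_cos_sub_two_mul (κ * x j) (κ * Δx / 2)
      rw [hsin_κ] at h
      rw [hUf, hUf, hUf, ← add_div, ← mul_div_assoc, hsucc, hpred]
      congr 1
      convert h using 2 <;> ring_nf
    have hcos : Real.cos (κ * x j) = (k ^ 2 - κt ^ 2) * Uf j := by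
      rw [hUf, mul_div_cancel₀ _ (sub_ne_zero.mpr hnres)]
    have hsum : U (j + 1) - 2 * U j + U (j - 1)
        = Δx ^ 2 * ((k ^ 2 - κt ^ 2) * Uf j - k ^ 2 * U j) := by
      simp only [hU]
      linear_combination hforced - Uf N / Real.sin (kt * L) * hleft
        - Uf 0 / Real.sin (kt * L) * hright
    rw [hsum, hcos, mul_div_cancel_left₀ _ (pow_ne_zero 2 hd.ne')]
    ring
  · rw [hU, hx0, ← hL, mul_div_cancel_right₀ _ hsin]
    simp
  · rw [hU, hxN, ← hL, mul_div_cancel_right₀ _ hsin]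
    simp
end

section
/- Fix k > 0 and real numbers a ≤ x. As Δx → 0⁺, with k̃(Δx) = (2/Δx) arcsin(kΔx/2), one has sin(k̃(Δx)(x − a)) = sin(k(x − a)) + (1/24) k (x − a) cos(k(x − a)) (kΔx)^2 + O(Δx^4). -/
open Real Filter Asymptotics Topology

theorem abs_arcsin_sub_cubic_le {t : ℝ} (ht : 0 ≤ t) (ht' : t ≤ 1 / 2) :
    |arcsin t - (t + t ^ 3 / 6)| ≤ 4 * t ^ 5 := by
  set θ := arcsin t with hθ
  have hsin : sin θ = t := sin_arcsin (by linarith) (by linarith)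
  have h0 : 0 ≤ θ := arcsin_nonneg.2 ht
  have hjordan : θ ≤ 2 * t := by
    have h := mul_le_sin h0 (arcsin_le_pi_div_two t)
    rw [hsin, div_mul_eq_mul_div, div_le_iff₀ pi_pos] at h
    nlinarith [pi_le_four]
  have htθ : t ≤ θ := hsin ▸ sin_le h0
  have hcube := sin_ge_sub_cube h0
  have hquint := sin_bound (x := θ) (by rw [abs_of_nonneg h0]; linarith)
  rw [hsin] at hcube hquint
  rw [abs_of_nonneg h0] at hquint
  have hpow : θ ^ 5 ≤ 32 * t ^ 5 := by
    calc θ ^ 5 ≤ (2 * t) ^ 5 := by gcongr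
      _ = 32 * t ^ 5 := by ring
  have hdiff_nonneg : 0 ≤ θ ^ 3 - t ^ 3 := sub_nonneg.2 (by gcongr)
  have hdiff : θ ^ 3 - t ^ 3 ≤ θ ^ 5 / 2 := by
    calc θ ^ 3 - t ^ 3 = (θ - t) * (θ ^ 2 + θ * t + t ^ 2) := by ring
      _ ≤ (θ ^ 3 / 6) * (θ ^ 2 + θ * θ + θ ^ 2) := by
        gcongr
        linarith
      _ = θ ^ 5 / 2 := by ring
  have ht5 : 0 ≤ t ^ 5 := by positivity
  rw [abs_le] at hquint ⊢
  constructor <;> linarith [hquint.1, hquint.2]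

theorem abs_sin_add_sub_linear_le (y d : ℝ) :
    |sin (y + d) - (sin y + d * cos y)| ≤ 2 * d ^ 2 := by
  have hcos : |cos d - 1| ≤ d ^ 2 / 2 := by
    rw [abs_le]
    constructor <;> nlinarith [one_sub_sq_div_two_le_cos (x := d), cos_le_one d]
  have hsin : |sin d - d| ≤ d ^ 2 := by
    rw [← sq_abs d]
    have h0 := abs_nonneg d
    rcases le_total |d| 2 with h | h
    · have := abs_sub_sin_le d
      rw [abs_sub_comm] at this
      nlinarith [pow_le_pow_left₀ h0 h 2, mul_nonneg (sq_nonneg |d|) (sub_nonneg.2 h)]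
    · have h1 := abs_sub (sin d) d
      have h2 := abs_sin_le_abs (x := d)
      nlinarith
  calc |sin (y + d) - (sin y + d * cos y)|
      = |sin y * (cos d - 1) + cos y * (sin d - d)| := by rw [sin_add]; ring_nf
    _ ≤ |sin y| * |cos d - 1| + |cos y| * |sin d - d| := by
      simpa only [abs_mul] using abs_add_le (sin y * (cos d - 1)) (cos y * (sin d - d))
    _ ≤ 1 * (d ^ 2 / 2) + 1 * d ^ 2 := by
      gcongr
      exacts [abs_sin_le_one y, abs_cos_le_one y]
    _ ≤ 2 * d ^ 2 := by nlinarith [sq_nonneg d]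

theorem abs_discrete_wavenumber_sub_le {k h : ℝ} (hk : 0 < k) (hh : 0 < h) (hkh : k * h ≤ 1) :
    |2 / h * arcsin (k * h / 2) - (k + k ^ 3 * h ^ 2 / 24)| ≤ k ^ 5 * h ^ 4 / 4 := by
  have hb := abs_arcsin_sub_cubic_le (t := k * h / 2) (by positivity) (by linarith)
  calc |2 / h * arcsin (k * h / 2) - (k + k ^ 3 * h ^ 2 / 24)|
      = |2 / h * (arcsin (k * h / 2) - (k * h / 2 + (k * h / 2) ^ 3 / 6))| := by
        congr 1
        field_simp
        ring
    _ = 2 / h * |arcsin (k * h / 2) - (k * h / 2 + (k * h / 2) ^ 3 / 6)| := by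
        rw [abs_mul, abs_of_pos (by positivity : 0 < 2 / h)]
    _ ≤ 2 / h * (4 * (k * h / 2) ^ 5) := by gcongr
    _ = k ^ 5 * h ^ 4 / 4 := by
        field_simp
        ring

theorem phase_expansion (k a x : ℝ) (hk : 0 < k) (hax : a ≤ x) :
    (fun Δx : ℝ =>
        Real.sin (((2 / Δx) * Real.arcsin (k * Δx / 2)) * (x - a)) -
          (Real.sin (k * (x - a)) +
            (1 / 24) * k * (x - a) * Real.cos (k * (x - a)) * (k * Δx) ^ 2))
      =O[𝓝[>] (0 : ℝ)] fun Δx : ℝ => Δx ^ 4 := by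
  obtain ⟨L, hL⟩ : ∃ L, L = x - a := ⟨_, rfl⟩
  have hL0 : 0 ≤ L := by linarith
  rw [← hL]
  refine IsBigO.of_bound (2 * L ^ 2 * k ^ 6 + L * k ^ 5) ?_
  filter_upwards [Ioo_mem_nhdsGT (one_div_pos.2 hk)] with h ⟨hh, hhk⟩
  have hkh : k * h ≤ 1 := by
    rw [lt_div_iff₀ hk] at hhk
    linarith
  have he := abs_discrete_wavenumber_sub_le hk hh hkh
  set e := 2 / h * arcsin (k * h / 2) - (k + k ^ 3 * h ^ 2 / 24) with he_def
  set d := (k ^ 3 * h ^ 2 / 24 + e) * L with hd_def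
  have he' : |e| ≤ k ^ 3 * h ^ 2 / 4 := by
    calc |e| ≤ k ^ 5 * h ^ 4 / 4 := he
      _ = k ^ 3 * h ^ 2 / 4 * (k * h) ^ 2 := by ring
      _ ≤ k ^ 3 * h ^ 2 / 4 * 1 ^ 2 := by gcongr
      _ = k ^ 3 * h ^ 2 / 4 := by ring
  have hd : |d| ≤ k ^ 3 * h ^ 2 * L := by
    have hp : 0 ≤ k ^ 3 * h ^ 2 := by positivity
    rw [hd_def, abs_mul, abs_of_nonneg hL0]
    gcongr
    rw [abs_le] at he' ⊢
    constructor <;> linarith [he'.1, he'.2]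
  have harg : 2 / h * arcsin (k * h / 2) * L = k * L + d := by
    rw [hd_def, he_def]
    ring
  rw [harg, Real.norm_eq_abs, Real.norm_eq_abs, abs_of_pos (pow_pos hh 4)]
  calc |sin (k * L + d) - (sin (k * L) + 1 / 24 * k * L * cos (k * L) * (k * h) ^ 2)|
      = |(sin (k * L + d) - (sin (k * L) + d * cos (k * L))) + e * L * cos (k * L)| := by
        congr 1
        rw [hd_def]
        ring
    _ ≤ |sin (k * L + d) - (sin (k * L) + d * cos (k * L))| + |e * L * cos (k * L)| :=
        abs_add_le _ _
    _ ≤ 2 * |d| ^ 2 + |e| * L * 1 := by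
        rw [sq_abs, abs_mul, abs_mul, abs_of_nonneg hL0]
        gcongr
        exacts [abs_sin_add_sub_linear_le _ _, abs_cos_le_one _]
    _ ≤ 2 * (k ^ 3 * h ^ 2 * L) ^ 2 + k ^ 5 * h ^ 4 / 4 * L * 1 := by gcongr
    _ ≤ (2 * L ^ 2 * k ^ 6 + L * k ^ 5) * h ^ 4 := by
        have : 0 ≤ k ^ 5 * h ^ 4 * L := by positivity
        linarith
end

section
/- Fix N_Λ > 0 and ε > 0, and for each positive integer μ set p = 2μ and PPW_p = 2π (π b_{p/2})^{1/p} (N_Λ/ε)^{1/p}, where b_μ = 2 (μ!)^2 / (2μ+2)!. Then PPW_p → π as μ → ∞. -/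
open Real Filter Topology

/-- The coefficient `2 (n!)² / (2n+2)!` in terms of the central binomial coefficient. -/
lemma two_mul_factorial_sq_div (n : ℕ) :
    2 * (Nat.factorial n : ℝ) ^ 2 / (Nat.factorial (2 * n + 2)) =
      2 / ((2 * n + 1) * (2 * n + 2) * (Nat.centralBinom n : ℝ)) := by
  have h : (Nat.centralBinom n : ℝ) * (Nat.factorial n : ℝ) ^ 2 = Nat.factorial (2 * n) := by
    have := Nat.choose_mul_factorial_mul_factorial (show n ≤ 2 * n by omega)
    rw [show 2 * n - n = n by omega, ← Nat.centralBinom_eq_two_mul_choose] at this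
    rw [← this]
    push_cast
    ring
  have hc : (Nat.centralBinom n : ℝ) ≠ 0 := by exact_mod_cast Nat.centralBinom_ne_zero n
  have hf : (Nat.factorial n : ℝ) ≠ 0 := by exact_mod_cast Nat.factorial_ne_zero n
  rw [Nat.factorial_succ, Nat.factorial_succ]
  push_cast
  rw [← h]
  field_simp
  ring

lemma four_pow_mul_coeff_le_one {n : ℕ} (hn : 0 < n) :
    (4 : ℝ) ^ n * (2 * (Nat.factorial n : ℝ) ^ 2 / (Nat.factorial (2 * n + 2))) ≤ 1 := by
  have hc : (0 : ℝ) < Nat.centralBinom n := by exact_mod_cast Nat.centralBinom_pos n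
  have h : (4 : ℝ) ^ n ≤ 2 * n * Nat.centralBinom n := by
    exact_mod_cast Nat.four_pow_le_two_mul_self_mul_centralBinom n hn
  rw [two_mul_factorial_sq_div, ← mul_div_assoc, div_le_one (by positivity)]
  have hn' : (0 : ℝ) ≤ n := by positivity
  nlinarith [mul_nonneg hn' hc.le, mul_nonneg (mul_nonneg hn' hn') hc.le]

lemma rpow_neg_two_le_four_pow_mul_coeff (n : ℕ) :
    (2 * n + 2 : ℝ) ^ (-2 : ℝ) ≤
      (4 : ℝ) ^ n * (2 * (Nat.factorial n : ℝ) ^ 2 / (Nat.factorial (2 * n + 2))) := by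
  have hc : (0 : ℝ) < Nat.centralBinom n := by exact_mod_cast Nat.centralBinom_pos n
  have h : (Nat.centralBinom n : ℝ) ≤ 4 ^ n := by
    exact_mod_cast Nat.centralBinom_le_four_pow n
  have hn : (0 : ℝ) ≤ n := by positivity
  rw [two_mul_factorial_sq_div, ← mul_div_assoc, Real.rpow_neg (by positivity), Real.rpow_two,
    inv_eq_one_div, div_le_div_iff₀ (by positivity) (by positivity), one_mul]
  calc (2 * n + 1) * (2 * n + 2) * (Nat.centralBinom n : ℝ)
      ≤ (2 * (2 * n + 2) ^ 2) * 4 ^ n := by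
        refine mul_le_mul ?_ h hc.le (by positivity)
        nlinarith
    _ = 4 ^ n * 2 * (2 * n + 2) ^ 2 := by ring

lemma tendsto_four_pow_mul_coeff_rpow :
    Tendsto (fun n : ℕ =>
      ((4 : ℝ) ^ n * (2 * (Nat.factorial n : ℝ) ^ 2 / (Nat.factorial (2 * n + 2)))) ^
        ((1 : ℝ) / (2 * n))) atTop (𝓝 1) := by
  have hx : Tendsto (fun n : ℕ => (2 * n + 2 : ℝ)) atTop atTop :=
    tendsto_atTop_add_const_right _ _
      (tendsto_natCast_atTop_atTop.const_mul_atTop two_pos)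
  have hlow := (tendsto_rpow_div_mul_add (-2) 1 (-2) zero_ne_one).comp hx
  refine tendsto_of_tendsto_of_tendsto_of_le_of_le' hlow tendsto_const_nhds ?_ ?_
  · refine Eventually.of_forall fun n => ?_
    have he : (-2 : ℝ) / (1 * (2 * n + 2) + -2) = -2 * (1 / (2 * n)) := by
      rw [show (1 * (2 * n + 2) + -2 : ℝ) = 2 * n by ring]
      ring
    simp only [Function.comp_apply]
    rw [he, Real.rpow_mul (by positivity)]
    exact Real.rpow_le_rpow (by positivity) (rpow_neg_two_le_four_pow_mul_coeff n) (by positivity)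
  · filter_upwards [eventually_gt_atTop 0] with n hn
    exact Real.rpow_le_one (by positivity) (four_pow_mul_coeff_le_one hn) (by positivity)

theorem ppw_limit (NΛ ε : ℝ) (hN : 0 < NΛ) (hε : 0 < ε) :
    Filter.Tendsto
      (fun μ : ℕ =>
        2 * Real.pi *
          (Real.pi * (2 * (Nat.factorial μ : ℝ) ^ 2 / (Nat.factorial (2 * μ + 2)))) ^
            ((1 : ℝ) / (2 * μ)) *
          (NΛ / ε) ^ ((1 : ℝ) / (2 * μ)))
      Filter.atTop (𝓝 Real.pi) := by
  have hr : Tendsto (fun n : ℕ => (1 : ℝ) / (2 * n)) atTop (𝓝 0) :=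
    tendsto_const_nhds.div_atTop (tendsto_natCast_atTop_atTop.const_mul_atTop two_pos)
  have hconst : ∀ a : ℝ, 0 < a →
      Tendsto (fun n : ℕ => a ^ ((1 : ℝ) / (2 * n))) atTop (𝓝 1) := fun a ha => by
    simpa using tendsto_const_nhds.rpow hr (Or.inl ha.ne')
  have hlim := ((tendsto_four_pow_mul_coeff_rpow.mul (hconst π pi_pos)).mul
    (hconst (NΛ / ε) (by positivity))).const_mul π
  simp only [mul_one] at hlim
  refine hlim.congr' ?_
  filter_upwards [eventually_gt_atTop 0] with n hn
  have hn' : (n : ℝ) ≠ 0 := by exact_mod_cast hn.ne'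
  have h4 : ((4 : ℝ) ^ n) ^ ((1 : ℝ) / (2 * n)) = 2 := by
    rw [show (4 : ℝ) = 2 ^ 2 by norm_num, ← pow_mul, ← Real.rpow_natCast, ← Real.rpow_mul two_pos.le]
    push_cast
    rw [mul_one_div_cancel (by positivity), Real.rpow_one]
  rw [Real.mul_rpow (by positivity) (by positivity), h4,
    Real.mul_rpow pi_pos.le (by positivity)]
  ring
end
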